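/- Let ε > 0 and let f : ℝ^d → ℝ^d be a continuous function with bounded range. Let P be the uniform-ball perturbation kernel associated to f and ε, and let μ be an invariant probability measure for P. Then the support of μ equals the closed ε-neighborhood of the image of the support under f: supp(μ) = { x ∈ ℝ^d : dist(x, f(supp(μ))) ≤ ε }. -/

import Mathlib

open MeasureTheory Metric Set

/-- The topological support of a measure: points all of whose open neighborhoods
have positive measure. -/
def measSupport {d : ℕ} (μ : Measure (EuclideanSpace ℝ (Fin d))) :
    Set (EuclideanSpace ℝ (Fin d)) :=
  {x | ∀ U : Set (EuclideanSpace ℝ (Fin d)), IsOpen U → x ∈ U → 0 < μ U}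

theorem measSupport_eq_support {d : ℕ} (μ : Measure (EuclideanSpace ℝ (Fin d))) :
    measSupport μ = μ.support := by
  ext x
  rw [Measure.mem_support_iff_forall]
  refine ⟨fun h U hU => ?_, fun h U hU hx => h U (hU.mem_nhds hx)⟩
  obtain ⟨V, hVU, hV, hxV⟩ := _root_.mem_nhds_iff.mp hU
  exact (h V hV hxV).trans_le (measure_mono hVU)

/-- The volume of the part of an open set lying in a ball of fixed radius depends measurably on
the center, when the center varies continuously. -/
theorem measurable_volume_inter_ball {d : ℕ} (ε : ℝ)
    {f : EuclideanSpace ℝ (Fin d) → EuclideanSpace ℝ (Fin d)} (hf : Continuous f)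
    {U : Set (EuclideanSpace ℝ (Fin d))} (hU : IsOpen U) :
    Measurable fun x => volume (U ∩ ball (f x) ε) := by
  have hopen : IsOpen {p : EuclideanSpace ℝ (Fin d) × EuclideanSpace ℝ (Fin d) |
      p.2 ∈ U ∧ dist p.2 (f p.1) < ε} :=
    (hU.preimage continuous_snd).inter (isOpen_lt
      (continuous_snd.dist (hf.comp continuous_fst)) continuous_const)
  exact measurable_measure_prodMk_left hopen.measurableSet

/-- For `ε > 0` and a continuous `f : ℝ^d → ℝ^d` with bounded range,
if `μ` is an invariant probability measure for the uniform-ball perturbation kernel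
`P(x, A) = vol(A ∩ B(f x, ε)) / vol(B(0, ε))`, then
`supp μ = {x | dist(x, f(supp μ)) ≤ ε}`. -/
theorem support_eq_closed_ball_nbhd_of_image
    (d : ℕ) (ε : ℝ) (hε : 0 < ε)
    (f : EuclideanSpace ℝ (Fin d) → EuclideanSpace ℝ (Fin d))
    (hf : Continuous f) (hb : Bornology.IsBounded (Set.range f))
    (μ : Measure (EuclideanSpace ℝ (Fin d))) [IsProbabilityMeasure μ]
    (hinv : ∀ A : Set (EuclideanSpace ℝ (Fin d)), MeasurableSet A →
      μ A = ∫⁻ x, volume (A ∩ ball (f x) ε) / volume (ball (0 : EuclideanSpace ℝ (Fin d)) ε) ∂μ) :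
    measSupport μ = {x | infDist x (f '' measSupport μ) ≤ ε} := by
  rw [measSupport_eq_support]
  have hne : (f '' μ.support).Nonempty :=
    (Measure.nonempty_support (IsProbabilityMeasure.ne_zero μ)).image f
  apply Subset.antisymm
  · have hclosed : IsClosed {x | infDist x (f '' μ.support) ≤ ε} :=
      isClosed_le (continuous_infDist_pt _) continuous_const
    refine Measure.support_subset_of_isClosed hclosed ?_
    rw [mem_ae_iff, hinv _ hclosed.measurableSet.compl]
    refine (lintegral_congr_ae ?_).trans lintegral_zero
    filter_upwards [Measure.support_mem_ae (μ := μ)] with y hy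
    have hempty : {x | infDist x (f '' μ.support) ≤ ε}ᶜ ∩ ball (f y) ε = ∅ := by
      ext x
      simp only [mem_inter_iff, mem_compl_iff, mem_ofPred_eq, mem_ball, mem_empty_iff_false,
        iff_false, not_and, not_lt, not_le]
      exact fun hx => hx.le.trans (infDist_le_dist_of_mem (mem_image_of_mem f hy))
    simp [hempty]
  · have hball : thickening ε (f '' μ.support) ⊆ μ.support := by
      intro z hz
      obtain ⟨_, ⟨y, hy, rfl⟩, hzy⟩ := mem_thickening_iff.mp hz
      rw [← measSupport_eq_support]
      intro U hU hzU
      have hV : IsOpen {w | dist z (f w) < ε} :=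
        isOpen_lt (continuous_const.dist hf) continuous_const
      rw [hinv U hU.measurableSet,
        lintegral_pos_iff_support ((measurable_volume_inter_ball ε hf hU).div_const _)]
      refine ((Measure.mem_support_iff_forall y).mp hy _ (hV.mem_nhds hzy)).trans_le
        (measure_mono fun w hw => ?_)
      have hpos : 0 < volume (U ∩ ball (f w) ε) :=
        (hU.inter isOpen_ball).measure_pos volume ⟨z, hzU, hw⟩
      exact (ENNReal.div_pos hpos.ne' measure_ball_lt_top.ne).ne'
    intro x hx
    have hmem : x ∈ cthickening ε (f '' μ.support) :=
      (ENNReal.le_ofReal_iff_toReal_le (infEDist_ne_top hne) hε.le).mpr hx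
    rw [← closure_thickening hε] at hmem
    exact closure_minimal hball Measure.isClosed_support hmem
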